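/- arXiv:2303.03134 — 2 statements merged into one kernel-verified Lean document; each statement's English description precedes it below -/
import Mathlib

section
/- Let p ≥ 1 and let A be an invertible p×p real matrix. The map X ↦ A X Aᵀ maps the real vector space Sym(p) of p×p real symmetric matrices to itself, is ℝ-linear, and its determinant has absolute value |det A|^{p+1}. -/
open Matrix

/-- The `ℝ`-linear endomorphism `X ↦ A X Aᵀ` of the real vector space of `p × p`
real symmetric matrices. -/
noncomputable def symCongrMap (p : ℕ) (A : Matrix (Fin p) (Fin p) ℝ) :
    selfAdjoint (Matrix (Fin p) (Fin p) ℝ) →ₗ[ℝ] selfAdjoint (Matrix (Fin p) (Fin p) ℝ) where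
  toFun X := ⟨A * (X : Matrix (Fin p) (Fin p) ℝ) * Aᵀ, by
    have hX : (X : Matrix (Fin p) (Fin p) ℝ)ᴴ = (X : Matrix (Fin p) (Fin p) ℝ) := X.2
    simp only [selfAdjoint.mem_iff, _root_.IsSelfAdjoint, star_eq_conjTranspose,
      conjTranspose_mul, conjTranspose_conjTranspose, hX, Matrix.mul_assoc]
    rfl⟩
  map_add' X Y := by
    ext
    simp [Matrix.mul_add, Matrix.add_mul]
  map_smul' c X := by
    ext
    simp [Matrix.mul_smul, Matrix.smul_mul]

theorem symCongrMap_one (p : ℕ) : symCongrMap p 1 = LinearMap.id := by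
  ext X : 2
  simp [symCongrMap]

theorem symCongrMap_mul (p : ℕ) (A B : Matrix (Fin p) (Fin p) ℝ) :
    symCongrMap p (A * B) = symCongrMap p A ∘ₗ symCongrMap p B := by
  ext X : 2
  simp [symCongrMap, Matrix.mul_assoc]

theorem det_symCongrMap_mul (p : ℕ) (A B : Matrix (Fin p) (Fin p) ℝ) :
    LinearMap.det (symCongrMap p (A * B)) =
      LinearMap.det (symCongrMap p A) * LinearMap.det (symCongrMap p B) := by
  rw [symCongrMap_mul, LinearMap.det_comp]

theorem det_symCongrMap_ne_zero_of_mul_eq_one {p : ℕ} {A B : Matrix (Fin p) (Fin p) ℝ}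
    (h : A * B = 1) : LinearMap.det (symCongrMap p A) ≠ 0 := by
  intro h0
  have := det_symCongrMap_mul p A B
  simp [h, symCongrMap_one, h0] at this

/-- A transvection is conjugate, by a diagonal matrix, to its square. -/
theorem det_symCongrMap_transvection {p : ℕ} {i j : Fin p} (hij : i ≠ j) (c : ℝ) :
    LinearMap.det (symCongrMap p (transvection i j c)) = 1 := by
  set D : Matrix (Fin p) (Fin p) ℝ := diagonal (Function.update 1 i 2) with hD
  have hDinv : D * diagonal (Function.update 1 i 2⁻¹) = 1 := by
    rw [hD, diagonal_mul_diagonal, ← diagonal_one]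
    congr 1
    ext k
    by_cases hk : k = i
    · subst hk; simp
    · simp [hk]
  have hconj : D * transvection i j c = transvection i j c * transvection i j c * D := by
    have hl : D * single i j c = single i j (c + c) := by
      ext a b
      by_cases ha : a = i
      · subst ha
        simp [hD, diagonal_mul, single_apply, two_mul]
      · simp [hD, diagonal_mul, ha, Ne.symm ha]
    have hr : single i j (c + c) * D = single i j (c + c) := by
      ext a b
      by_cases hb : b = i
      · subst hb
        simp [hD, mul_diagonal, hij.symm]
      · simp [hD, mul_diagonal, hb]
    rw [transvection_mul_transvection_same _ _ hij, transvection, transvection, Matrix.mul_add,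
      Matrix.add_mul, hl, hr, Matrix.mul_one, Matrix.one_mul]
  have hT : transvection i j c * transvection i j (-c) = 1 := by
    rw [transvection_mul_transvection_same _ _ hij]
    simp
  have hdet := congrArg (fun M ↦ LinearMap.det (symCongrMap p M)) hconj
  simp only [det_symCongrMap_mul] at hdet
  have hD0 := det_symCongrMap_ne_zero_of_mul_eq_one hDinv
  have hT0 := det_symCongrMap_ne_zero_of_mul_eq_one hT
  refine (mul_left_cancel₀ (mul_ne_zero hD0 hT0) ?_).symm
  linear_combination hdet

/-- A real symmetric matrix is determined by its entries on and above the diagonal. -/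
noncomputable def symUpperEquiv (p : ℕ) :
    selfAdjoint (Matrix (Fin p) (Fin p) ℝ) ≃ₗ[ℝ] ({x : Fin p × Fin p // x.1 ≤ x.2} → ℝ) where
  toFun X x := (X : Matrix (Fin p) (Fin p) ℝ) x.1.1 x.1.2
  map_add' X Y := by ext x; simp
  map_smul' c X := by ext x; simp
  invFun f := ⟨of fun i j ↦ f ⟨(min i j, max i j), min_le_max⟩, by
    rw [selfAdjoint.mem_iff, star_eq_conjTranspose]
    ext i j
    simp [min_comm, max_comm]⟩
  left_inv X := by
    ext i j
    have hX : (X : Matrix (Fin p) (Fin p) ℝ) j i = (X : Matrix (Fin p) (Fin p) ℝ) i j :=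
      congrFun (congrFun (show (X : Matrix (Fin p) (Fin p) ℝ)ᴴ = X from X.2) i) j
    rcases le_total i j with h | h <;> simp [h, hX]
  right_inv f := by
    ext ⟨⟨i, j⟩, h⟩
    have h' : i ≤ j := h
    simp [h']

theorem det_symCongrMap_diagonal (p : ℕ) (d : Fin p → ℝ) :
    LinearMap.det (symCongrMap p (diagonal d)) =
      ∏ x : {x : Fin p × Fin p // x.1 ≤ x.2}, d x.1.1 * d x.1.2 := by
  rw [← LinearMap.det_conj _ (symUpperEquiv p)]
  have h : (symUpperEquiv p).toLinearMap ∘ₗ symCongrMap p (diagonal d) ∘ₗ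
      (symUpperEquiv p).symm.toLinearMap =
      LinearMap.pi fun x : {x : Fin p × Fin p // x.1 ≤ x.2} ↦
        ((d x.1.1 * d x.1.2) • LinearMap.id (R := ℝ) (M := ℝ)) ∘ₗ LinearMap.proj x := by
    refine LinearMap.ext fun f ↦ ?_
    obtain ⟨X, rfl⟩ := (symUpperEquiv p).surjective f
    ext x
    simp [symUpperEquiv, symCongrMap, diagonal_mul, mul_diagonal, min_eq_left x.2,
      max_eq_right x.2]
    ring
  rw [h, LinearMap.det_pi]
  simp

theorem prod_upper_mul_sq (p : ℕ) (d : Fin p → ℝ) :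
    (∏ x : {x : Fin p × Fin p // x.1 ≤ x.2}, d x.1.1 * d x.1.2) ^ 2 =
      ((∏ i, d i) ^ (p + 1)) ^ 2 := by
  have hsub : (∏ x : {x : Fin p × Fin p // x.1 ≤ x.2}, d x.1.1 * d x.1.2) =
      ∏ i, ∏ j, if i ≤ j then d i * d j else 1 := by
    rw [← Fintype.prod_prod_type', ← Finset.prod_filter]
    exact (Finset.prod_subtype _ (p := fun x : Fin p × Fin p ↦ x.1 ≤ x.2) (by simp)
      fun x ↦ d x.1 * d x.2).symm
  have hpt (i j : Fin p) : ((if i ≤ j then d i * d j else 1) * if j ≤ i then d j * d i else 1) =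
      (d i * d j) * if i = j then d i * d j else 1 := by
    rcases lt_trichotomy i j with h | h | h
    · simp [h.le, h.not_ge, h.ne]
    · simp [h]
    · simp [h.le, h.not_ge, h.ne', mul_comm]
  rw [hsub, sq]
  nth_rewrite 2 [Finset.prod_comm]
  simp_rw [← Finset.prod_mul_distrib, hpt, Finset.prod_mul_distrib]
  simp [Finset.prod_mul_distrib, Finset.prod_pow]
  ring

theorem abs_det_symCongrMap_diagonal (p : ℕ) (d : Fin p → ℝ) :
    |LinearMap.det (symCongrMap p (diagonal d))| = |(diagonal d).det| ^ (p + 1) := by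
  rw [det_symCongrMap_diagonal, det_diagonal, ← abs_pow]
  exact (sq_eq_sq_iff_abs_eq_abs _ _).1 (prod_upper_mul_sq p d)

theorem stmt2 (p : ℕ) (hp : 1 ≤ p) (A : Matrix (Fin p) (Fin p) ℝ) (hA : IsUnit A.det) :
    |LinearMap.det (symCongrMap p A)| = |A.det| ^ (p + 1) := by
  refine diagonal_transvection_induction_of_det_ne_zero
    (fun M ↦ |LinearMap.det (symCongrMap p M)| = |M.det| ^ (p + 1)) A hA.ne_zero
    (fun d _ ↦ abs_det_symCongrMap_diagonal p d) (fun t ↦ ?_) (fun M N _ _ hM hN ↦ ?_)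
  · rw [TransvectionStruct.det, TransvectionStruct.toMatrix,
      det_symCongrMap_transvection t.hij]
    simp
  · rw [det_symCongrMap_mul, abs_mul, hM, hN, det_mul, abs_mul, mul_pow]
end

section
/- Let p ≥ 1. Parametrize the set of p×p complex lower-triangular matrices T = (t_{ij}) with t_{ij} = 0 for i < j, strictly positive real diagonal entries t_{jj} > 0, and arbitrary complex strictly-lower entries t_{ij} (i > j), by the product of (0,∞)^p (for the diagonal) and ℂ^{p(p-1)/2} (for the strictly-lower entries), with Lebesgue measure dT on this parameter space. Then the pushforward under the map Φ(T) = T T* of the measure with density 2^p ∏_{j=1}^p t_{jj}^{2(p-j)+1} with respect to dT equals the restriction to the cone of positive definite matrices of the Lebesgue measure μ_p on Herm(p). -/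
open MeasureTheory Matrix
open scoped ComplexOrder

noncomputable section

/-- Parameter space `ℝ^p × ℂ^{p(p-1)/2}` for `p × p` Hermitian matrices:
the real diagonal entries together with the strictly upper-triangular complex entries. -/
abbrev HermParam (p : ℕ) : Type :=
  (Fin p → ℝ) × ({ q : Fin p × Fin p // q.1 < q.2 } → ℂ)

/-- The linear isomorphism sending the parameters to the corresponding self-adjoint matrix. -/
def toHermMatrix (p : ℕ) (T : HermParam p) : Matrix (Fin p) (Fin p) ℂ :=
  Matrix.of fun i j =>
    if h : i < j then T.2 ⟨(i, j), h⟩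
    else if h' : j < i then (starRingEnd ℂ) (T.2 ⟨(j, i), h'⟩)
    else (T.1 i : ℂ)

noncomputable instance matrixComplexMeasureSpace (m n : ℕ) :
    MeasureSpace (Matrix (Fin m) (Fin n) ℂ) :=
  inferInstanceAs (MeasureSpace (Fin m → Fin n → ℂ))

/-- The Lebesgue measure `μ_p` on Herm(p), realized as a measure on the space of
`p × p` complex matrices: the pushforward of Lebesgue measure on the parameter space
under the linear isomorphism `toHermMatrix p`. -/
def hermLebesgue (p : ℕ) : Measure (Matrix (Fin p) (Fin p) ℂ) :=
  Measure.map (toHermMatrix p) volume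

/-- The complex matrix-variate gamma function
`Γ̃_p(α) = π^{p(p-1)/2} ∏_{j=1}^p Γ(α - j + 1) = π^{p(p-1)/2} ∏_{j=0}^{p-1} Γ(α - j)`. -/
def cGammaP (p : ℕ) (α : ℂ) : ℂ :=
  (Real.pi : ℂ) ^ (p * (p - 1) / 2) * ∏ j : Fin p, Complex.Gamma (α - j)

end

noncomputable section

/-- Parameter space `ℝ^p × ℂ^{p(p-1)/2}` for `p × p` lower-triangular matrices with real
diagonal: the diagonal entries together with the strictly lower-triangular complex entries. -/
abbrev LowerParam (p : ℕ) : Type :=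
  (Fin p → ℝ) × ({ q : Fin p × Fin p // q.2 < q.1 } → ℂ)

/-- The lower-triangular matrix `T` with diagonal `T.1` and strictly lower entries `T.2`. -/
def toLowerMatrix (p : ℕ) (T : LowerParam p) : Matrix (Fin p) (Fin p) ℂ :=
  Matrix.of fun i j =>
    if h : j < i then T.2 ⟨(i, j), h⟩
    else if i = j then (T.1 i : ℂ)
    else 0

/-- The density `2^p ∏_{j=1}^p t_jj^{2(p-j)+1}` on the set where all diagonal entries are
strictly positive. -/
def lowerDensity (p : ℕ) (T : LowerParam p) : ENNReal :=
  if ∀ j, 0 < T.1 j then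
    ENNReal.ofReal (2 ^ p * ∏ j : Fin p, (T.1 j) ^ (2 * (p - 1 - (j : ℕ)) + 1))
  else 0

end

section BorderedMatrix

variable {p : ℕ}

/-- The `(p + 1) × (p + 1)` matrix with corner `a`, first row `u`, first column `w` and
remaining block `B`. -/
noncomputable def bordered (a : ℂ) (u w : Fin p → ℂ) (B : Matrix (Fin p) (Fin p) ℂ) :
    Matrix (Fin (p + 1)) (Fin (p + 1)) ℂ :=
  Matrix.of (Fin.cons (Fin.cons a u) fun i => Fin.cons (w i) (B i))

@[simp] lemma bordered_zero_zero (a : ℂ) (u w : Fin p → ℂ) (B : Matrix (Fin p) (Fin p) ℂ) :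
    bordered a u w B 0 0 = a := rfl

@[simp] lemma bordered_zero_succ (a : ℂ) (u w : Fin p → ℂ) (B : Matrix (Fin p) (Fin p) ℂ)
    (j : Fin p) : bordered a u w B 0 j.succ = u j := rfl

@[simp] lemma bordered_succ_zero (a : ℂ) (u w : Fin p → ℂ) (B : Matrix (Fin p) (Fin p) ℂ)
    (i : Fin p) : bordered a u w B i.succ 0 = w i := rfl

@[simp] lemma bordered_succ_succ (a : ℂ) (u w : Fin p → ℂ) (B : Matrix (Fin p) (Fin p) ℂ)
    (i j : Fin p) : bordered a u w B i.succ j.succ = B i j := rfl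

lemma eq_bordered {a : ℂ} {u w : Fin p → ℂ} {B : Matrix (Fin p) (Fin p) ℂ}
    {M : Matrix (Fin (p + 1)) (Fin (p + 1)) ℂ} (h₀ : M 0 0 = a) (hu : ∀ j, M 0 (Fin.succ j) = u j)
    (hw : ∀ i, M (Fin.succ i) 0 = w i) (hB : ∀ i j, M (Fin.succ i) (Fin.succ j) = B i j) :
    M = bordered a u w B := by
  ext i j
  refine Fin.cases ?_ (fun i => ?_) i <;> refine Fin.cases ?_ (fun j => ?_) j <;> simp [*]

lemma bordered_mul (a b : ℂ) (u w x y : Fin p → ℂ) (A B : Matrix (Fin p) (Fin p) ℂ) :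
    bordered a u w A * bordered b x y B =
      bordered (a * b + u ⬝ᵥ y) (a • x + u ᵥ* B) (b • w + A *ᵥ y) (vecMulVec w x + A * B) := by
  apply eq_bordered
  · simp [Matrix.mul_apply, Fin.sum_univ_succ, dotProduct]
  · intro j
    simp [Matrix.mul_apply, Fin.sum_univ_succ, vecMul, dotProduct]
  · intro i
    simp [Matrix.mul_apply, Fin.sum_univ_succ, mulVec, dotProduct, mul_comm]
  · intro i j
    simp [Matrix.mul_apply, Fin.sum_univ_succ, vecMulVec]

lemma bordered_conjTranspose (a : ℂ) (u w : Fin p → ℂ) (B : Matrix (Fin p) (Fin p) ℂ) :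
    (bordered a u w B)ᴴ = bordered (star a) (star w) (star u) Bᴴ := by
  apply eq_bordered <;> simp

lemma posDef_bordered_diag {a : ℂ} (ha : 0 < a) {B : Matrix (Fin p) (Fin p) ℂ} :
    (bordered a 0 0 B).PosDef ↔ B.PosDef := by
  constructor
  · intro h
    exact h.submatrix (Fin.succ_injective p)
  · intro h
    have ha' : star a = a := (IsSelfAdjoint.of_nonneg ha.le).star_eq
    refine Matrix.PosDef.of_dotProduct_mulVec_pos ?_ fun x hx => ?_
    · simp [Matrix.IsHermitian, bordered_conjTranspose, h.isHermitian.eq, ha']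
    · have key : star x ⬝ᵥ (bordered a 0 0 B *ᵥ x) =
          a * (star (x 0) * x 0) + star (Fin.tail x) ⬝ᵥ (B *ᵥ Fin.tail x) := by
        simp [dotProduct, mulVec, Fin.sum_univ_succ, Fin.tail]
        ring
      rw [key]
      by_cases ht : Fin.tail x = 0
      · have h0 : x 0 ≠ 0 := by
          intro h0
          apply hx
          rw [← Fin.cons_self_tail x, ht, h0]
          ext i
          refine Fin.cases ?_ (fun i => ?_) i <;> simp
        rw [ht]
        simpa using mul_pos ha (star_mul_self_pos (IsRegular.of_ne_zero h0))
      · exact add_pos_of_nonneg_of_pos (mul_nonneg ha.le (star_mul_self_nonneg _))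
          (h.dotProduct_mulVec_pos ht)

/-- Schur complement criterion for positive definiteness of a bordered matrix. -/
lemma posDef_bordered_iff {a : ℂ} (ha : 0 < a) (w : Fin p → ℂ) (B : Matrix (Fin p) (Fin p) ℂ) :
    (bordered a (star w) w B).PosDef ↔
      (B - vecMulVec (a⁻¹ • w) (star w)).PosDef := by
  have ha' : star a = a := (IsSelfAdjoint.of_nonneg ha.le).star_eq
  have hu : IsUnit (bordered 1 0 (a⁻¹ • w) (1 : Matrix (Fin p) (Fin p) ℂ)) := by
    refine IsUnit.of_mul_eq_one (bordered 1 0 (-(a⁻¹ • w)) 1) ?_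
    rw [bordered_mul]
    symm
    apply eq_bordered <;> simp [Matrix.one_apply, Fin.succ_inj, eq_comm]
  rw [← posDef_bordered_diag (B := B - _) ha,
    ← hu.posDef_star_right_conjugate_iff (x := bordered a 0 0 _), star_eq_conjTranspose,
    bordered_conjTranspose, bordered_mul, bordered_mul]
  have : a ≠ 0 := ha.ne'
  congr! 2
  · simp
  · ext; simp [ha', this]
  · ext; simp [this]
  · ext i j
    simp [vecMulVec, ha', this]
    ring

end BorderedMatrix

/-- The strictly lower-triangular positions of a `(p + 1) × (p + 1)` matrix are those of the first
column together with those of the remaining block. -/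
noncomputable def strictLowerSuccEquiv (p : ℕ) :
    Fin p ⊕ { q : Fin p × Fin p // q.2 < q.1 } ≃ { q : Fin (p + 1) × Fin (p + 1) // q.2 < q.1 } :=
  Equiv.ofBijective
    (Sum.elim (fun i => ⟨(i.succ, 0), i.succ_pos⟩)
      fun q => ⟨(q.1.1.succ, q.1.2.succ), Fin.succ_lt_succ_iff.2 q.2⟩) (by
    constructor
    · rintro (i | ⟨⟨i, j⟩, hij⟩) (k | ⟨⟨k, l⟩, hkl⟩) h <;> simp_all [eq_comm]
    · rintro ⟨⟨i, j⟩, h⟩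
      dsimp at h
      obtain ⟨i, rfl⟩ := Fin.exists_succ_eq.2 (Fin.ne_zero_of_lt h)
      refine Fin.cases (fun h => ?_) (fun j h => ?_) j h
      · exact ⟨Sum.inl i, rfl⟩
      · exact ⟨Sum.inr ⟨(i, j), Fin.succ_lt_succ_iff.1 h⟩, rfl⟩)

/-- The parameter with corner `t`, first column `v` and remaining block `S`. -/
noncomputable def LowerParam.cons {p : ℕ} (t : ℝ) (v : Fin p → ℂ) (S : LowerParam p) :
    LowerParam (p + 1) :=
  (Fin.cons t S.1, fun q => Sum.elim v S.2 ((strictLowerSuccEquiv p).symm q))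

lemma LowerParam.cons_fst_succ {p : ℕ} (t : ℝ) (v : Fin p → ℂ) (S : LowerParam p) (i : Fin p) :
    (LowerParam.cons t v S).1 i.succ = S.1 i := rfl

lemma LowerParam.cons_snd_zero {p : ℕ} (t : ℝ) (v : Fin p → ℂ) (S : LowerParam p) (i : Fin p)
    (h : (0 : Fin (p + 1)) < i.succ) : (LowerParam.cons t v S).2 ⟨(i.succ, 0), h⟩ = v i := by
  have : (strictLowerSuccEquiv p).symm ⟨(i.succ, 0), h⟩ = Sum.inl i := by
    rw [Equiv.symm_apply_eq]; rfl
  simp [LowerParam.cons, this]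

lemma LowerParam.cons_snd_succ {p : ℕ} (t : ℝ) (v : Fin p → ℂ) (S : LowerParam p) (i j : Fin p)
    (h : j.succ < i.succ) : (LowerParam.cons t v S).2 ⟨(i.succ, j.succ), h⟩ =
      S.2 ⟨(i, j), Fin.succ_lt_succ_iff.1 h⟩ := by
  have : (strictLowerSuccEquiv p).symm ⟨(i.succ, j.succ), h⟩ =
      Sum.inr ⟨(i, j), Fin.succ_lt_succ_iff.1 h⟩ := by
    rw [Equiv.symm_apply_eq]; rfl
  simp [LowerParam.cons, this]

lemma LowerParam.measurable_cons (p : ℕ) :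
    Measurable fun x : ℝ × (Fin p → ℂ) × LowerParam p => LowerParam.cons x.1 x.2.1 x.2.2 := by
  refine Measurable.prodMk (measurable_pi_iff.2 fun i => ?_) (measurable_pi_iff.2 fun q => ?_)
  · refine Fin.cases ?_ (fun i => ?_) i
    · simpa using measurable_fst
    · simp only [Fin.cons_succ]; fun_prop
  · rcases (strictLowerSuccEquiv p).symm q with i | q
    · simp only [Sum.elim_inl]; fun_prop
    · simp only [Sum.elim_inr]; fun_prop

lemma lintegral_lowerParam_succ (p : ℕ) {F : LowerParam (p + 1) → ENNReal} (hF : Measurable F) :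
    ∫⁻ T, F T = ∫⁻ t : ℝ, ∫⁻ v : Fin p → ℂ, ∫⁻ S : LowerParam p, F (LowerParam.cons t v S) := by
  have e₁ := (volume_preserving_piFinSuccAbove (fun _ : Fin (p + 1) => ℝ) 0).symm
  have e₂ := (volume_measurePreserving_piCongrLeft (fun _ => ℂ) (strictLowerSuccEquiv p)).comp
    (volume_measurePreserving_sumPiEquivProdPi_symm (fun _ : Fin p ⊕ _ => ℂ))
  have e := e₁.prod e₂
  rw [← Measure.volume_eq_prod, ← Measure.volume_eq_prod] at e
  have hcons : ∀ x : (ℝ × (Fin p → ℝ)) × ((Fin p → ℂ) × ({ q : Fin p × Fin p // q.2 < q.1 } → ℂ)),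
      Prod.map (MeasurableEquiv.piFinSuccAbove (fun _ : Fin (p + 1) => ℝ) 0).symm
        (MeasurableEquiv.piCongrLeft (fun _ => ℂ) (strictLowerSuccEquiv p) ∘
          (MeasurableEquiv.sumPiEquivProdPi (fun _ : Fin p ⊕ _ => ℂ)).symm) x =
      LowerParam.cons x.1.1 x.2.1 (x.1.2, x.2.2) := by
    intro x
    refine Prod.ext ?_ ?_
    · exact (Fin.insertNth_zero (α := fun _ => ℝ) x.1.1 x.1.2).trans rfl
    · funext q
      obtain ⟨q, rfl⟩ := (strictLowerSuccEquiv p).surjective q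
      have : (MeasurableEquiv.piCongrLeft (fun _ => ℂ) (strictLowerSuccEquiv p))
        ((MeasurableEquiv.sumPiEquivProdPi (fun _ : Fin p ⊕ _ => ℂ)).symm x.2)
          (strictLowerSuccEquiv p q) =
          ((MeasurableEquiv.sumPiEquivProdPi (fun _ : Fin p ⊕ _ => ℂ)).symm x.2) q :=
        Equiv.piCongrLeft_apply_apply _ _ _ _
      refine this.trans ?_
      rcases q with i | q <;> simp [LowerParam.cons] <;> rfl
  have hG : Measurable fun x : (ℝ × (Fin p → ℝ)) ×
      ((Fin p → ℂ) × ({ q : Fin p × Fin p // q.2 < q.1 } → ℂ)) =>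
      F (LowerParam.cons x.1.1 x.2.1 (x.1.2, x.2.2)) :=
    hF.comp ((LowerParam.measurable_cons p).comp (f := fun x : (ℝ × (Fin p → ℝ)) ×
      ((Fin p → ℂ) × ({ q : Fin p × Fin p // q.2 < q.1 } → ℂ)) =>
      (x.1.1, x.2.1, (x.1.2, x.2.2))) (by fun_prop))
  rw [← e.lintegral_comp hF]
  simp only [hcons]
  rw [Measure.volume_eq_prod, lintegral_prod _ hG.aemeasurable, Measure.volume_eq_prod,
    lintegral_prod _ (Measurable.lintegral_prod_right' hG).aemeasurable]
  refine lintegral_congr fun t => ?_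
  have : ∀ d : Fin p → ℝ, ∫⁻ y : (Fin p → ℂ) × ({ q : Fin p × Fin p // q.2 < q.1 } → ℂ),
      F (LowerParam.cons t y.1 (d, y.2)) = ∫⁻ v, ∫⁻ l, F (LowerParam.cons t v (d, l)) := by
    intro d
    rw [Measure.volume_eq_prod, lintegral_prod]
    exact (hG.comp (measurable_prodMk_left (x := (t, d)))).aemeasurable
  simp only [this]
  rw [lintegral_lintegral_swap]
  · refine lintegral_congr fun v => ?_
    rw [Measure.volume_eq_prod, lintegral_prod]
    exact (hF.comp ((LowerParam.measurable_cons p).comp (f := fun x => (t, v, x))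
      (by fun_prop))).aemeasurable
  · refine Measurable.aemeasurable ?_
    refine Measurable.lintegral_prod_right' (f := fun z : ((Fin p → ℝ) × (Fin p → ℂ)) ×
      ({ q : Fin p × Fin p // q.2 < q.1 } → ℂ) =>
      F (LowerParam.cons t z.1.2 (z.1.1, z.2))) ?_
    exact hF.comp ((LowerParam.measurable_cons p).comp (f := fun z :
      ((Fin p → ℝ) × (Fin p → ℂ)) × ({ q : Fin p × Fin p // q.2 < q.1 } → ℂ) =>
      (t, z.1.2, (z.1.1, z.2)))
      (by fun_prop))

/-- The Hermitian matrix with diagonal `T.1` and strictly lower entries `T.2`. -/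
noncomputable def lowerHermMatrix (p : ℕ) (T : LowerParam p) : Matrix (Fin p) (Fin p) ℂ :=
  Matrix.of fun i j =>
    if h : j < i then T.2 ⟨(i, j), h⟩
    else if h' : i < j then star (T.2 ⟨(j, i), h'⟩)
    else (T.1 i : ℂ)

/-- The parameter of a Hermitian matrix. -/
def lowerParamOfMatrix {p : ℕ} (M : Matrix (Fin p) (Fin p) ℂ) : LowerParam p :=
  (fun i => (M i i).re, fun q => M q.1.1 q.1.2)

lemma lowerHermMatrix_lowerParamOfMatrix {p : ℕ} {M : Matrix (Fin p) (Fin p) ℂ}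
    (hM : M.IsHermitian) : lowerHermMatrix p (lowerParamOfMatrix M) = M := by
  ext i j
  rcases lt_trichotomy i j with h | rfl | h
  · simpa [lowerHermMatrix, lowerParamOfMatrix, h, h.not_gt] using hM.apply i j
  · simpa [lowerHermMatrix, lowerParamOfMatrix] using Complex.conj_eq_iff_re.1 (hM.apply i i)
  · simp [lowerHermMatrix, lowerParamOfMatrix, h]

lemma lowerHermMatrix_add {p : ℕ} (S T : LowerParam p) :
    lowerHermMatrix p (S + T) = lowerHermMatrix p S + lowerHermMatrix p T := by
  ext i j
  simp only [lowerHermMatrix, Matrix.of_apply, Matrix.add_apply]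
  split_ifs <;> simp

lemma measurable_matrix {α : Type*} [MeasurableSpace α] {m n : ℕ}
    {F : α → Matrix (Fin m) (Fin n) ℂ} (h : ∀ i j, Measurable fun x => F x i j) : Measurable F :=
  measurable_pi_iff.2 fun i => measurable_pi_iff.2 fun j => h i j

lemma measurable_matrix_apply {m n : ℕ} (i : Fin m) (j : Fin n) :
    Measurable fun M : Matrix (Fin m) (Fin n) ℂ => M i j :=
  (measurable_pi_apply j).comp (measurable_pi_apply i)

lemma measurable_lowerHermMatrix (p : ℕ) : Measurable (lowerHermMatrix p) := by
  refine measurable_matrix fun i j => ?_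
  simp only [lowerHermMatrix, Matrix.of_apply]
  split_ifs <;> fun_prop

lemma measurable_toHermMatrix (p : ℕ) : Measurable (toHermMatrix p) := by
  refine measurable_matrix fun i j => ?_
  simp only [toHermMatrix, Matrix.of_apply]
  split_ifs
  · fun_prop
  · exact Complex.continuous_conj.measurable.comp (by fun_prop)
  · fun_prop

lemma measurable_toLowerMatrix (p : ℕ) : Measurable (toLowerMatrix p) := by
  refine measurable_matrix fun i j => ?_
  simp only [toLowerMatrix, Matrix.of_apply]
  split_ifs <;> fun_prop

lemma measurable_lowerMatrix_mul_conjTranspose (p : ℕ) :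
    Measurable fun T : LowerParam p => toLowerMatrix p T * (toLowerMatrix p T)ᴴ := by
  refine measurable_matrix fun i j => ?_
  simp only [Matrix.mul_apply, Matrix.conjTranspose_apply]
  exact Finset.measurable_sum _ fun k _ =>
    ((measurable_matrix_apply i k).comp (measurable_toLowerMatrix p)).mul
      (Complex.continuous_conj.measurable.comp
        ((measurable_matrix_apply j k).comp (measurable_toLowerMatrix p)))

lemma measurable_lowerDensity (p : ℕ) : Measurable (lowerDensity p) := by
  refine Measurable.ite ?_ (by fun_prop) measurable_const
  simp only [Set.ofPred_forall]
  exact MeasurableSet.iInter fun j => measurableSet_lt measurable_const (by fun_prop)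

lemma Measurable.bordered {α : Type*} [MeasurableSpace α] {p : ℕ} {a : α → ℂ}
    {u w : α → Fin p → ℂ} {B : α → Matrix (Fin p) (Fin p) ℂ} (ha : Measurable a)
    (hu : Measurable u) (hw : Measurable w) (hB : Measurable B) :
    Measurable fun x => bordered (a x) (u x) (w x) (B x) := by
  refine measurable_matrix fun i j => ?_
  refine Fin.cases ?_ (fun i => ?_) i <;> refine Fin.cases ?_ (fun j => ?_) j
  · exact ha
  · exact (measurable_pi_apply j).comp hu
  · exact (measurable_pi_apply i).comp hw
  · exact (measurable_matrix_apply i j).comp hB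

lemma measurableSet_posDef (p : ℕ) :
    MeasurableSet {X : Matrix (Fin p) (Fin p) ℂ | X.PosDef} := by
  have : OpensMeasurableSpace (Matrix (Fin p) (Fin p) ℂ) :=
    inferInstanceAs (OpensMeasurableSpace (Fin p → Fin p → ℂ))
  have h : {X : Matrix (Fin p) (Fin p) ℂ | X.PosDef} = {X | X.PosSemidef} ∩ {X | X.det ≠ 0} := by
    ext X
    exact ⟨fun h => ⟨h.posSemidef, h.det_pos.ne'⟩, fun h => h.1.posDef_iff_det_ne_zero.2 h.2⟩
  rw [h]
  refine MeasurableSet.inter (IsClosed.measurableSet ?_) (IsOpen.measurableSet ?_)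
  · simp only [Matrix.posSemidef_iff_dotProduct_mulVec, Matrix.IsHermitian, Set.ofPred_and,
      Set.ofPred_forall]
    refine IsClosed.inter (isClosed_eq (by fun_prop) continuous_id) (isClosed_iInter fun x => ?_)
    exact isClosed_le continuous_const (by fun_prop)
  · exact isOpen_ne_fun (by fun_prop) continuous_const

lemma hermLebesgue_eq_map_lowerHermMatrix (p : ℕ) :
    hermLebesgue p = Measure.map (lowerHermMatrix p) volume := by
  let e : { q : Fin p × Fin p // q.2 < q.1 } ≃ { q : Fin p × Fin p // q.1 < q.2 } :=
    (Equiv.prodComm _ _).subtypeEquiv fun q => Iff.rfl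
  have h₁ := volume_measurePreserving_piCongrLeft (fun _ => ℂ) e
  have h₂ : MeasurePreserving
      (fun (l : { q : Fin p × Fin p // q.1 < q.2 } → ℂ) q => (starRingEnd ℂ) (l q)) :=
    volume_preserving_pi fun _ => Complex.conjLIE.measurePreserving
  have h := (MeasurePreserving.id (volume : Measure (Fin p → ℝ))).prod (h₂.comp h₁)
  rw [← Measure.volume_eq_prod, ← Measure.volume_eq_prod] at h
  rw [hermLebesgue, ← h.map_eq, Measure.map_map (measurable_toHermMatrix p) h.measurable]
  congr 1
  funext T
  have he : ∀ i j (h : i < j),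
      MeasurableEquiv.piCongrLeft (fun _ => ℂ) e T.2 ⟨(i, j), h⟩ = T.2 ⟨(j, i), h⟩ :=
    fun i j h => Equiv.piCongrLeft_apply_apply (fun _ => ℂ) e T.2 ⟨(j, i), h⟩
  ext i j
  rcases lt_trichotomy i j with hij | rfl | hij
  · simp [toHermMatrix, lowerHermMatrix, hij, hij.not_gt, he]
  · simp [toHermMatrix, lowerHermMatrix]
  · simp [toHermMatrix, lowerHermMatrix, hij, hij.not_gt, he]

lemma lowerHermMatrix_cons {p : ℕ} (t : ℝ) (v : Fin p → ℂ) (S : LowerParam p) :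
    lowerHermMatrix (p + 1) (LowerParam.cons t v S) =
      bordered t (star v) v (lowerHermMatrix p S) := by
  apply eq_bordered
  · simp [lowerHermMatrix, LowerParam.cons]
  · intro j
    simp [lowerHermMatrix, LowerParam.cons_snd_zero]
  · intro i
    simp [lowerHermMatrix, LowerParam.cons_snd_zero]
  · intro i j
    simp [lowerHermMatrix, LowerParam.cons_snd_succ, LowerParam.cons_fst_succ]

lemma toLowerMatrix_cons {p : ℕ} (t : ℝ) (v : Fin p → ℂ) (S : LowerParam p) :
    toLowerMatrix (p + 1) (LowerParam.cons t v S) = bordered t 0 v (toLowerMatrix p S) := by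
  apply eq_bordered
  · simp [toLowerMatrix, LowerParam.cons]
  · intro j
    simp [toLowerMatrix, (Fin.succ_ne_zero j).symm]
  · intro i
    simp [toLowerMatrix, LowerParam.cons_snd_zero]
  · intro i j
    simp [toLowerMatrix, LowerParam.cons_snd_succ, LowerParam.cons_fst_succ]

lemma toLowerMatrix_cons_mul_conjTranspose {p : ℕ} (t : ℝ) (v : Fin p → ℂ) (S : LowerParam p) :
    toLowerMatrix (p + 1) (LowerParam.cons t v S) *
        (toLowerMatrix (p + 1) (LowerParam.cons t v S))ᴴ =
      bordered ((t ^ 2 : ℝ) : ℂ) (star (t • v)) (t • v)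
        (vecMulVec v (star v) + toLowerMatrix p S * (toLowerMatrix p S)ᴴ) := by
  rw [toLowerMatrix_cons, bordered_conjTranspose, bordered_mul]
  congr 1
  · simp [sq]
  · ext; simp
  · ext; simp

lemma lowerDensity_cons {p : ℕ} (t : ℝ) (v : Fin p → ℂ) (S : LowerParam p) :
    lowerDensity (p + 1) (LowerParam.cons t v S) =
      (Set.Ioi 0).indicator (fun t : ℝ => ENNReal.ofReal (2 * t ^ (2 * p + 1))) t *
        lowerDensity p S := by
  have hexp : ∀ j : Fin p, p - ((j : ℕ) + 1) = p - 1 - j := fun j => by omega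
  by_cases ht : 0 < t <;> by_cases hS : ∀ j, 0 < S.1 j
  · simp only [lowerDensity, LowerParam.cons, Fin.forall_fin_succ, Fin.cons_zero, Fin.cons_succ,
      ht, hS, implies_true, and_self, if_true, Set.mem_Ioi, Set.indicator_of_mem,
      Fin.prod_univ_succ, Fin.val_zero, Fin.val_succ, Nat.add_sub_cancel, hexp, Nat.sub_zero]
    rw [← ENNReal.ofReal_mul (by positivity)]
    congr 1
    ring
  all_goals simp [lowerDensity, LowerParam.cons, Fin.forall_fin_succ, ht, hS]

lemma lintegral_pi_complex_comp_smul {p : ℕ} {t : ℝ} (ht : 0 < t) {G : (Fin p → ℂ) → ENNReal}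
    (hG : Measurable G) :
    ENNReal.ofReal (t ^ (2 * p)) * ∫⁻ v, G (t • v) = ∫⁻ w, G w := by
  have hdim : Module.finrank ℝ (Fin p → ℂ) = 2 * p := by
    rw [Module.finrank_pi_fintype]; simp [Complex.finrank_real_complex, mul_comm]
  have h := Measure.map_addHaar_smul (volume : Measure (Fin p → ℂ)) ht.ne'
  rw [hdim] at h
  rw [← lintegral_map hG (measurable_const_smul t), h, lintegral_smul_measure, smul_eq_mul,
    ← mul_assoc, ← ENNReal.ofReal_mul (by positivity), abs_of_pos (by positivity),
    mul_inv_cancel₀ (by positivity), ENNReal.ofReal_one, one_mul]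

lemma lintegral_Ioi_comp_sq (g : ℝ → ENNReal) :
    ∫⁻ t in Set.Ioi (0 : ℝ), ENNReal.ofReal (2 * t) * g (t ^ 2) = ∫⁻ a in Set.Ioi (0 : ℝ), g a := by
  have himg : (fun t : ℝ => t ^ 2) '' Set.Ioi 0 = Set.Ioi 0 := by
    ext a
    constructor
    · rintro ⟨t, ht, rfl⟩
      exact pow_pos (Set.mem_Ioi.1 ht) 2
    · intro ha
      exact ⟨√a, Real.sqrt_pos.2 ha, Real.sq_sqrt (le_of_lt ha)⟩
  have h := lintegral_image_eq_lintegral_abs_deriv_mul (f := fun t : ℝ => t ^ 2)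
    (f' := fun t => 2 * t) (s := Set.Ioi 0) measurableSet_Ioi
    (fun x _ => by simpa using (hasDerivAt_pow 2 x).hasDerivWithinAt)
    (fun x hx y hy hxy => by
      simpa using (pow_left_inj₀ (le_of_lt hx) (le_of_lt hy) two_ne_zero).1 hxy) g
  rw [himg] at h
  rw [h]
  refine setLIntegral_congr_fun measurableSet_Ioi fun t ht => ?_
  have ht' : (0 : ℝ) < t := ht
  simp only [abs_of_pos (mul_pos two_pos ht')]

/-- Integrating over the remaining block, a shift by `v vᴴ` turns positive definiteness of that
block into positive definiteness of the bordered matrix. -/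
lemma lintegral_shift_posDef {p : ℕ} {t : ℝ} (ht : 0 < t) (v : Fin p → ℂ)
    (f : Matrix (Fin (p + 1)) (Fin (p + 1)) ℂ → ENNReal) :
    ∫⁻ X, {M : Matrix (Fin p) (Fin p) ℂ | M.PosDef}.indicator
        (fun M => f (bordered ((t ^ 2 : ℝ) : ℂ) (star (t • v)) (t • v)
          (vecMulVec v (star v) + M))) (lowerHermMatrix p X) =
      ∫⁻ X, {M : Matrix (Fin (p + 1)) (Fin (p + 1)) ℂ | M.PosDef}.indicator f
        (bordered ((t ^ 2 : ℝ) : ℂ) (star (t • v)) (t • v) (lowerHermMatrix p X)) := by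
  set R : LowerParam p := lowerParamOfMatrix (vecMulVec v (star v)) with hR
  have hherm : (vecMulVec v (star v)).IsHermitian := by
    ext i j
    simp [vecMulVec, mul_comm]
  have hinv : (volume : Measure (LowerParam p)).IsAddLeftInvariant :=
    Measure.prod.instIsAddLeftInvariant
  rw [← lintegral_add_left_eq_self (fun X : LowerParam p =>
    {M : Matrix (Fin (p + 1)) (Fin (p + 1)) ℂ | M.PosDef}.indicator f
        (bordered ((t ^ 2 : ℝ) : ℂ) (star (t • v)) (t • v) (lowerHermMatrix p X))) R]
  refine lintegral_congr fun X => ?_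
  rw [lowerHermMatrix_add, hR, lowerHermMatrix_lowerParamOfMatrix hherm]
  have hpos : (0 : ℂ) < ((t ^ 2 : ℝ) : ℂ) := by exact_mod_cast pow_pos ht 2
  have hschur : (bordered ((t ^ 2 : ℝ) : ℂ) (star (t • v)) (t • v)
      (vecMulVec v (star v) + lowerHermMatrix p X)).PosDef ↔ (lowerHermMatrix p X).PosDef := by
    rw [posDef_bordered_iff hpos]
    have ht' : (t : ℂ) ≠ 0 := by exact_mod_cast ht.ne'
    congr! 1
    ext i j
    simp [vecMulVec]
    field_simp
    ring
  by_cases hX : (lowerHermMatrix p X).PosDef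
  · rw [Set.indicator_of_mem (by exact hX), Set.indicator_of_mem (by exact hschur.2 hX)]
  · rw [Set.indicator_of_notMem (by exact hX),
      Set.indicator_of_notMem (by exact fun h => hX (hschur.1 h))]

/-- The change of variables `X = T Tᴴ` for nonnegative functions. -/
theorem lintegral_lowerDensity_mul (p : ℕ) {f : Matrix (Fin p) (Fin p) ℂ → ENNReal}
    (hf : Measurable f) :
    ∫⁻ T, lowerDensity p T * f (toLowerMatrix p T * (toLowerMatrix p T)ᴴ) =
      ∫⁻ X, {M : Matrix (Fin p) (Fin p) ℂ | M.PosDef}.indicator f (lowerHermMatrix p X) := by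
  induction p with
  | zero =>
    refine lintegral_congr fun T => ?_
    have hX : (lowerHermMatrix 0 T).PosDef := by
      rw [Subsingleton.elim (lowerHermMatrix 0 T) 1]
      exact Matrix.PosDef.one
    rw [Set.indicator_of_mem (by exact hX), Subsingleton.elim (lowerHermMatrix 0 T)
      (toLowerMatrix 0 T * (toLowerMatrix 0 T)ᴴ)]
    simp [lowerDensity]
  | succ p ih =>
    have hfPD := hf.indicator (measurableSet_posDef (p + 1))
    set fPD := {M : Matrix (Fin (p + 1)) (Fin (p + 1)) ℂ | M.PosDef}.indicator f with hfPD_def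
    set G : ℝ → (Fin p → ℂ) → ENNReal := fun a w =>
      ∫⁻ X, fPD (bordered (a : ℂ) (star w) w (lowerHermMatrix p X)) with hG_def
    have hG : ∀ a, Measurable (G a) := fun a => by
      refine Measurable.lintegral_prod_right' (f := fun x : (Fin p → ℂ) × LowerParam p =>
        fPD (bordered (a : ℂ) (star x.1) x.1 (lowerHermMatrix p x.2))) (hfPD.comp ?_)
      exact Measurable.bordered measurable_const
        (continuous_star.measurable.comp measurable_fst) measurable_fst
        ((measurable_lowerHermMatrix p).comp measurable_snd)
    have hinner : ∀ t : ℝ, 0 < t → ∀ v : Fin p → ℂ,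
        ∫⁻ S, lowerDensity p S * f (bordered ((t ^ 2 : ℝ) : ℂ) (star (t • v)) (t • v)
          (vecMulVec v (star v) + toLowerMatrix p S * (toLowerMatrix p S)ᴴ)) =
        G (t ^ 2) (t • v) := by
      intro t ht v
      rw [hG_def, hfPD_def]
      dsimp only
      rw [← lintegral_shift_posDef ht]
      refine ih (f := fun M => f (bordered ((t ^ 2 : ℝ) : ℂ) (star (t • v)) (t • v)
        (vecMulVec v (star v) + M))) (hf.comp ?_)
      refine Measurable.bordered measurable_const measurable_const measurable_const ?_
      exact measurable_matrix fun i j => measurable_const.add (measurable_matrix_apply i j)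
    have hleft : ∀ t : ℝ, ∫⁻ v : Fin p → ℂ, ∫⁻ S : LowerParam p,
        lowerDensity (p + 1) (LowerParam.cons t v S) *
          f (toLowerMatrix (p + 1) (LowerParam.cons t v S) *
            (toLowerMatrix (p + 1) (LowerParam.cons t v S))ᴴ) =
        (Set.Ioi 0).indicator (fun t => ENNReal.ofReal (2 * t) * ∫⁻ w, G (t ^ 2) w) t := by
      intro t
      simp only [lowerDensity_cons, toLowerMatrix_cons_mul_conjTranspose]
      by_cases ht : t ∈ Set.Ioi (0 : ℝ)
      · have ht' : 0 < t := ht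
        simp only [Set.indicator_of_mem ht, mul_assoc]
        simp only [lintegral_const_mul' _ _ ENNReal.ofReal_ne_top, hinner t ht']
        rw [← lintegral_pi_complex_comp_smul ht' (hG _), ← mul_assoc,
          ← ENNReal.ofReal_mul (by positivity)]
        congr 2
        ring
      · simp [Set.indicator_of_notMem ht]
    have hright : ∀ a : ℝ, ∫⁻ w : Fin p → ℂ, ∫⁻ X : LowerParam p,
        fPD (lowerHermMatrix (p + 1) (LowerParam.cons a w X)) =
        (Set.Ioi 0).indicator (fun a => ∫⁻ w, G a w) a := by
      intro a
      simp only [lowerHermMatrix_cons]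
      by_cases ha : a ∈ Set.Ioi (0 : ℝ)
      · rw [Set.indicator_of_mem ha]
      · have hzero : ∀ (w : Fin p → ℂ) X,
            fPD (bordered (a : ℂ) (star w) w (lowerHermMatrix p X)) = 0 := fun w X => by
          refine Set.indicator_of_notMem (fun h => ha ?_) f
          have h0 : (0 : ℂ) < a := Matrix.PosDef.diag_pos h (i := 0)
          exact_mod_cast h0
        simp [hzero, Set.indicator_of_notMem ha]
    have hmeas : Measurable fun T : LowerParam (p + 1) =>
        lowerDensity (p + 1) T * f (toLowerMatrix (p + 1) T * (toLowerMatrix (p + 1) T)ᴴ) :=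
      (measurable_lowerDensity _).mul (hf.comp (measurable_lowerMatrix_mul_conjTranspose _))
    have hmeas' : Measurable fun X : LowerParam (p + 1) => fPD (lowerHermMatrix (p + 1) X) :=
      hfPD.comp (measurable_lowerHermMatrix _)
    rw [lintegral_lowerParam_succ p hmeas, lintegral_lowerParam_succ p hmeas']
    simp only [hleft, hright]
    rw [lintegral_indicator measurableSet_Ioi, lintegral_indicator measurableSet_Ioi]
    exact lintegral_Ioi_comp_sq fun a => ∫⁻ w, G a w

theorem stmt4 (p : ℕ) (hp : 1 ≤ p) :
    Measure.map (fun T : LowerParam p => toLowerMatrix p T * (toLowerMatrix p T)ᴴ)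
      ((volume : Measure (LowerParam p)).withDensity (lowerDensity p)) =
    (hermLebesgue p).restrict {X : Matrix (Fin p) (Fin p) ℂ | X.PosDef} := by
  refine Measure.ext_of_lintegral _ fun f hf => ?_
  have hT := measurable_lowerMatrix_mul_conjTranspose p
  rw [lintegral_map hf hT]
  refine (lintegral_withDensity_eq_lintegral_mul _ (measurable_lowerDensity p)
    (hf.comp hT)).trans ?_
  rw [← lintegral_indicator (measurableSet_posDef p),
    hermLebesgue_eq_map_lowerHermMatrix,
    lintegral_map (hf.indicator (measurableSet_posDef p)) (measurable_lowerHermMatrix p)]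
  exact lintegral_lowerDensity_mul p hf
end
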